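/- arXiv:2402.03091 — 2 statements merged into one kernel-verified Lean document; each statement's English description precedes it below -/
import Mathlib

section
/- Let n = 1. Let F ∈ Lip_loc(ℝ) satisfy F(p) = p for p ∈ [0,1] and F(p) ≤ p for p ∈ [−1,0], and let g(x) = max{1 − |x|, 0} for x ∈ ℝ. For ε ∈ (0, 1/4), let u^ε be a bounded uniformly continuous viscosity solution of u_t + F(u_x) = ε u_xx in ℝ×(0,∞) with u^ε(·,0) = g, and let u be a bounded uniformly continuous viscosity solution of u_t + F(u_x) = 0 in ℝ×(0,∞) with u(·,0) = g. Then |u^ε(0,1) − u(0,1)| ≥ ((e−1)/(√π · e)) √ε. -/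
noncomputable section

/-- `w` is a viscosity subsolution of `w_t + F(w_x) = ε w_xx` in `ℝ × (0,∞)`:
for every `C²` test function `φ` and every point `(x₀,t₀)` with `t₀ > 0` at which
`w - φ` attains a local maximum, `∂_t φ + F(∂_x φ) ≤ ε ∂²_{xx} φ` at `(x₀,t₀)`. -/
def IsViscositySubsolution (F : ℝ → ℝ) (ε : ℝ) (w : ℝ × ℝ → ℝ) : Prop :=
  ∀ φ : ℝ × ℝ → ℝ, ContDiff ℝ 2 φ →
    ∀ x₀ t₀ : ℝ, 0 < t₀ →
      IsLocalMax (fun p => w p - φ p) (x₀, t₀) →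
      deriv (fun τ => φ (x₀, τ)) t₀ + F (deriv (fun ξ => φ (ξ, t₀)) x₀)
        ≤ ε * deriv (deriv (fun ξ => φ (ξ, t₀))) x₀

/-- `w` is a viscosity supersolution of `w_t + F(w_x) = ε w_xx` in `ℝ × (0,∞)`. -/
def IsViscositySupersolution (F : ℝ → ℝ) (ε : ℝ) (w : ℝ × ℝ → ℝ) : Prop :=
  ∀ φ : ℝ × ℝ → ℝ, ContDiff ℝ 2 φ →
    ∀ x₀ t₀ : ℝ, 0 < t₀ →
      IsLocalMin (fun p => w p - φ p) (x₀, t₀) →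
      ε * deriv (deriv (fun ξ => φ (ξ, t₀))) x₀
        ≤ deriv (fun τ => φ (x₀, τ)) t₀ + F (deriv (fun ξ => φ (ξ, t₀)) x₀)

/-- `w` is a bounded uniformly continuous viscosity solution of the Cauchy problem
`w_t + F(w_x) = ε w_xx` in `ℝ × (0,∞)`, `w(·,0) = g`. -/
def IsViscositySolutionCauchy (F : ℝ → ℝ) (ε : ℝ) (g : ℝ → ℝ) (w : ℝ × ℝ → ℝ) : Prop :=
  (∃ M : ℝ, ∀ p : ℝ × ℝ, |w p| ≤ M) ∧
  UniformContinuousOn w {p : ℝ × ℝ | 0 ≤ p.2} ∧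
  IsViscositySubsolution F ε w ∧
  IsViscositySupersolution F ε w ∧
  (∀ x : ℝ, w (x, 0) = g x)

open Set Filter Topology

/-- Comparison of a viscosity subsolution with a smooth supersolution. -/
theorem sub_comparison (F : ℝ → ℝ) (hF : Continuous F) (ε : ℝ) (hε : 0 ≤ ε)
    (w v : ℝ × ℝ → ℝ) (C : ℝ)
    (hC : ∀ p : ℝ × ℝ, 0 ≤ p.2 → w p - v p ≤ C)
    (hw : ContinuousOn w {p : ℝ × ℝ | 0 ≤ p.2})
    (hsub : IsViscositySubsolution F ε w) (hv : ContDiff ℝ 2 v)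
    (h0 : ∀ x, w (x, 0) ≤ v (x, 0))
    (hvx : ∀ x t, 0 < t → deriv (fun ξ => v (ξ, t)) x ∈ Icc (-1:ℝ) 1)
    (hsup : ∀ x t, 0 < t → ε * deriv (deriv (fun ξ => v (ξ, t))) x ≤
      deriv (fun τ => v (x, τ)) t + F (deriv (fun ξ => v (ξ, t)) x))
    (x₁ t₁ : ℝ) (ht₁ : 0 < t₁) : w (x₁, t₁) ≤ v (x₁, t₁) := by
  by_contra hcon
  push Not at hcon
  set d := w (x₁, t₁) - v (x₁, t₁) with hd
  have hdpos : 0 < d := by rw [hd]; linarith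
  have hCd : d ≤ C := hC (x₁, t₁) ht₁.le
  have hCpos : 0 < C := by linarith
  obtain ⟨η, hη, hηt⟩ : ∃ η : ℝ, 0 < η ∧ η * t₁ ≤ d / 4 :=
    ⟨d / 4 / t₁, by positivity, by field_simp; rfl⟩
  have huc : UniformContinuousOn F (Icc (-2:ℝ) 2) :=
    isCompact_Icc.uniformContinuousOn_of_continuous hF.continuousOn
  obtain ⟨ρ', hρ', hFρ'⟩ := Metric.uniformContinuousOn_iff.1 huc (η / 2) (by positivity)
  obtain ⟨ρ, hρ, hρ1, hFρ⟩ : ∃ ρ : ℝ, 0 < ρ ∧ ρ ≤ 1 ∧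
      ∀ p q : ℝ, p ∈ Icc (-1:ℝ) 1 → |q| < ρ → F p ≤ F (p + q) + η / 2 := by
    refine ⟨min ρ' 1, by positivity, min_le_right _ _, ?_⟩
    intro p q hp hq
    have hq1 := lt_of_lt_of_le hq (min_le_left _ _)
    have hq2 := lt_of_lt_of_le hq (min_le_right _ _)
    rw [abs_lt] at hq2
    have := hFρ' p ⟨by linarith [hp.1], by linarith [hp.2]⟩ (p + q)
      ⟨by linarith [hp.1], by linarith [hp.2]⟩ (by simpa [Real.dist_eq] using hq1)
    rw [Real.dist_eq, abs_lt] at this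
    linarith [this.2]
  obtain ⟨β, hβ, hβx, hβρ, hβε⟩ : ∃ β : ℝ, 0 < β ∧ β * x₁ ^ 2 ≤ d / 4 ∧
      4 * β * C < ρ ^ 2 ∧ 2 * ε * β < η / 2 := by
    have e1 : ∀ᶠ β in 𝓝[>] (0:ℝ), β * x₁ ^ 2 < d / 4 := by
      refine (((show Continuous (fun β : ℝ => β * x₁ ^ 2) by fun_prop).tendsto 0).mono_left
        nhdsWithin_le_nhds).eventually_lt_const (by simpa using by linarith)
    have e2 : ∀ᶠ β in 𝓝[>] (0:ℝ), 4 * β * C < ρ ^ 2 := by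
      refine (((show Continuous (fun β : ℝ => 4 * β * C) by fun_prop).tendsto 0).mono_left
        nhdsWithin_le_nhds).eventually_lt_const (by simpa using by positivity)
    have e3 : ∀ᶠ β in 𝓝[>] (0:ℝ), 2 * ε * β < η / 2 := by
      refine (((show Continuous (fun β : ℝ => 2 * ε * β) by fun_prop).tendsto 0).mono_left
        nhdsWithin_le_nhds).eventually_lt_const (by simpa using by positivity)
    obtain ⟨β, h1, h2, h3, h4⟩ := (e1.and (e2.and (e3.and self_mem_nhdsWithin))).exists
    exact ⟨β, h4, h1.le, h2, h3⟩
  set φ : ℝ × ℝ → ℝ := fun p => v p + (η * p.2 + β * p.1 ^ 2) with hφ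
  have hφc : ContDiff ℝ 2 φ := by
    rw [hφ]; fun_prop
  -- existence of a maximum
  set R : ℝ := C / β + 1 with hR
  set T : ℝ := C / η + 1 with hT
  have hRpos : 1 ≤ R := by have : 0 < C / β := by positivity
                           linarith
  have hTpos : 1 ≤ T := by have : 0 < C / η := by positivity
                           linarith
  have hβR : β * R = C + β := by rw [hR]; field_simp
  have hηT : η * T = C + η := by rw [hT]; field_simp
  have hout : ∀ p : ℝ × ℝ, 0 ≤ p.2 → 0 ≤ w p - φ p → |p.1| ≤ R ∧ p.2 ≤ T := by
    intro p hp hpos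
    have h1 := hC p hp
    have h2 : η * p.2 + β * p.1 ^ 2 ≤ C := by simp only [hφ] at hpos; linarith
    have h3 : 0 ≤ β * p.1 ^ 2 := by positivity
    have h4 : 0 ≤ η * p.2 := by positivity
    constructor
    · by_contra hh
      push Not at hh
      have : R * R ≤ |p.1| * |p.1| := by nlinarith
      have h5 : R ≤ p.1 ^ 2 := by rw [← sq_abs]; nlinarith
      nlinarith
    · by_contra hh
      push Not at hh
      nlinarith
  have hval : d / 2 ≤ w (x₁, t₁) - φ (x₁, t₁) := by
    simp only [hφ]; linarith
  have hKc : IsCompact ((Icc (-R) R) ×ˢ (Icc 0 T) : Set (ℝ × ℝ)) :=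
    isCompact_Icc.prod isCompact_Icc
  have hmem1 : (x₁, t₁) ∈ ((Icc (-R) R) ×ˢ (Icc 0 T) : Set (ℝ × ℝ)) := by
    have := hout (x₁, t₁) ht₁.le (by linarith)
    exact ⟨abs_le.1 this.1, ht₁.le, this.2⟩
  obtain ⟨⟨x₀, t₀⟩, hmem0, hmax⟩ := hKc.exists_isMaxOn ⟨_, hmem1⟩
    (f := fun p => w p - φ p) ((hw.mono (fun p hp => hp.2.1)).sub hφc.continuous.continuousOn)
  have hge : d / 2 ≤ w (x₀, t₀) - φ (x₀, t₀) := hval.trans (hmax hmem1)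
  have ht₀' : 0 ≤ t₀ := hmem0.2.1
  have ht₀ : 0 < t₀ := by
    rcases ht₀'.lt_or_eq with h | h
    · exact h
    · subst h
      have := h0 x₀
      have h3 : 0 ≤ β * x₀ ^ 2 := by positivity
      simp only [hφ] at hge
      linarith
  have hloc : IsLocalMax (fun p => w p - φ p) (x₀, t₀) := by
    have hn : {p : ℝ × ℝ | 0 < p.2} ∈ 𝓝 (x₀, t₀) :=
      (isOpen_lt continuous_const continuous_snd).mem_nhds ht₀
    filter_upwards [hn] with p hp
    by_cases hpos : 0 ≤ w p - φ p
    · have := hout p (le_of_lt hp) hpos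
      exact hmax ⟨abs_le.1 this.1, le_of_lt hp, this.2⟩
    · linarith
  have hineq := hsub φ hφc x₀ t₀ ht₀ hloc
  have hvX : ContDiff ℝ 2 (fun ξ => v (ξ, t₀)) := by fun_prop
  have hvT : ContDiff ℝ 2 (fun τ => v (x₀, τ)) := by fun_prop
  have hdT : deriv (fun τ => φ (x₀, τ)) t₀ = deriv (fun τ => v (x₀, τ)) t₀ + η := by
    have h1 := (hvT.differentiable (by norm_num) t₀).hasDerivAt
    have h2 : HasDerivAt (fun τ : ℝ => η * τ + β * x₀ ^ 2) η t₀ := by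
      simpa using ((hasDerivAt_id t₀).const_mul η).add_const (β * x₀ ^ 2)
    exact (h1.add h2).deriv
  have hdX : deriv (fun ξ => φ (ξ, t₀)) = fun x => deriv (fun ξ => v (ξ, t₀)) x + 2 * β * x := by
    funext x
    have h1 := (hvX.differentiable (by norm_num) x).hasDerivAt
    have h2 : HasDerivAt (fun ξ : ℝ => η * t₀ + β * ξ ^ 2) (2 * β * x) x := by
      have := ((hasDerivAt_pow 2 x).const_mul β).const_add (η * t₀)
      refine this.congr_deriv ?_
      push_cast; ring
    exact (h1.add h2).deriv
  have hdXX : deriv (deriv (fun ξ => φ (ξ, t₀))) x₀ =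
      deriv (deriv (fun ξ => v (ξ, t₀))) x₀ + 2 * β := by
    rw [hdX]
    have h3 : ContDiff ℝ (1 + 1) (fun ξ => v (ξ, t₀)) := by simpa [one_add_one_eq_two] using hvX
    have h1 := (((contDiff_succ_iff_deriv.1 h3).2.2).differentiable (by norm_num) x₀).hasDerivAt
    have h2 : HasDerivAt (fun ξ : ℝ => 2 * β * ξ) (2 * β) x₀ := by
      simpa using (hasDerivAt_id x₀).const_mul (2 * β)
    exact (h1.add h2).deriv
  rw [hdXX, hdT, hdX] at hineq
  have hq : |2 * β * x₀| < ρ := by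
    apply abs_lt_of_sq_lt_sq _ hρ.le
    have h1 := hC (x₀, t₀) ht₀'
    have h2 : β * x₀ ^ 2 ≤ C := by
      have : 0 ≤ η * t₀ := by positivity
      simp only [hφ] at hge; linarith
    nlinarith
  have h5 := hFρ _ _ (hvx x₀ t₀ ht₀) hq
  have h6 := hsup x₀ t₀ ht₀
  nlinarith

/-- Comparison of a viscosity supersolution with a smooth subsolution. -/
theorem super_comparison (F : ℝ → ℝ) (hF : Continuous F) (ε : ℝ) (hε : 0 ≤ ε)
    (w v : ℝ × ℝ → ℝ) (C : ℝ)
    (hC : ∀ p : ℝ × ℝ, 0 ≤ p.2 → v p - w p ≤ C)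
    (hw : ContinuousOn w {p : ℝ × ℝ | 0 ≤ p.2})
    (hsuper : IsViscositySupersolution F ε w) (hv : ContDiff ℝ 2 v)
    (h0 : ∀ x, v (x, 0) ≤ w (x, 0))
    (hvx : ∀ x t, 0 < t → deriv (fun ξ => v (ξ, t)) x ∈ Icc (-1:ℝ) 1)
    (hsub : ∀ x t, 0 < t → 
      deriv (fun τ => v (x, τ)) t + F (deriv (fun ξ => v (ξ, t)) x) ≤
      ε * deriv (deriv (fun ξ => v (ξ, t))) x)
    (x₁ t₁ : ℝ) (ht₁ : 0 < t₁) : v (x₁, t₁) ≤ w (x₁, t₁) := by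
  have dn : ∀ f : ℝ → ℝ, deriv (fun x => - f x) = fun x => - deriv f x := by
    intro f; funext x; exact deriv.fun_neg
  have key := sub_comparison (fun p => - F (-p)) (by fun_prop) ε hε (fun p => - w p)
    (fun p => - v p) C (fun p hp => by linarith [hC p hp]) hw.neg ?_ hv.neg
    (fun x => by linarith [h0 x]) ?_ ?_ x₁ t₁ ht₁
  · simpa using key
  · intro φ hφ x₀ t₀ ht hmax
    have := hsuper (fun p => - φ p) hφ.neg x₀ t₀ ht (by
      have := hmax.neg
      refine this.congr (Eventually.of_forall fun p => ?_)
      simp; ring)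
    simp only [dn] at this
    linarith
  · intro x t ht
    have := hvx x t ht
    simp only [dn]
    exact ⟨by linarith [this.2], by linarith [this.1]⟩
  · intro x t ht
    have := hsub x t ht
    simp only [dn, neg_neg]
    linarith

/-- Gaussian distribution function. -/
def Nf (z : ℝ) : ℝ := 1 / 2 + (∫ y in (0:ℝ)..z, Real.exp (-y ^ 2)) / Real.sqrt Real.pi

/-- The profile of the heat flow of the positive part. -/
def kf (z : ℝ) : ℝ := z * Nf z + Real.exp (-z ^ 2) / (2 * Real.sqrt Real.pi)

theorem sqrtpi_pos : 0 < Real.sqrt Real.pi := Real.sqrt_pos.2 Real.pi_pos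

theorem hasDerivAt_Nf (z : ℝ) :
    HasDerivAt Nf (Real.exp (-z ^ 2) / Real.sqrt Real.pi) z := by
  have hc : Continuous fun y : ℝ => Real.exp (-y ^ 2) := by fun_prop
  exact ((hc.integral_hasStrictDerivAt 0 z).hasDerivAt.div_const _).const_add _

theorem hasDerivAt_expsq (z : ℝ) :
    HasDerivAt (fun z : ℝ => Real.exp (-z ^ 2)) (-(2 * z) * Real.exp (-z ^ 2)) z := by
  have h : HasDerivAt (fun z : ℝ => -z ^ 2) (-(2 * z)) z := by
    simpa using (hasDerivAt_pow 2 z).fun_neg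
  have := h.exp
  rwa [mul_comm] at this

theorem hasDerivAt_kf (z : ℝ) : HasDerivAt kf (Nf z) z := by
  have h1 := (hasDerivAt_id z).mul (hasDerivAt_Nf z)
  have h2 := (hasDerivAt_expsq z).div_const (2 * Real.sqrt Real.pi)
  have := h1.add h2
  refine this.congr_deriv ?_
  have := sqrtpi_pos
  simp only [id]
  field_simp
  ring

theorem contDiff_Nf : ContDiff ℝ 1 Nf := by
  rw [contDiff_one_iff_deriv]
  refine ⟨fun z => (hasDerivAt_Nf z).differentiableAt, ?_⟩
  have : deriv Nf = fun z => Real.exp (-z ^ 2) / Real.sqrt Real.pi :=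
    funext fun z => (hasDerivAt_Nf z).deriv
  rw [this]; fun_prop

theorem contDiff_kf : ContDiff ℝ 2 kf := by
  have : ContDiff ℝ (1 + 1) kf := by
    rw [contDiff_succ_iff_deriv]
    refine ⟨fun z => (hasDerivAt_kf z).differentiableAt, by simp, ?_⟩
    have : deriv kf = Nf := funext fun z => (hasDerivAt_kf z).deriv
    rw [this]; exact contDiff_Nf
  simpa [one_add_one_eq_two] using this

theorem Nf_mono : Monotone Nf := by
  refine monotone_of_deriv_nonneg (fun z => (hasDerivAt_Nf z).differentiableAt) fun z => ?_
  rw [(hasDerivAt_Nf z).deriv]; positivity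

theorem Nf_neg (z : ℝ) : Nf (-z) = 1 - Nf z := by
  have : ∫ y in (0:ℝ)..(-z), Real.exp (-y ^ 2) = - ∫ y in (0:ℝ)..z, Real.exp (-y ^ 2) := by
    have h := intervalIntegral.integral_comp_neg (a := 0) (b := z)
      (fun y : ℝ => Real.exp (-y ^ 2))
    simp only [neg_sq, neg_zero] at h
    rw [h, intervalIntegral.integral_symm]
  unfold Nf
  rw [this]; ring

theorem Nf_tendsto : Tendsto Nf atTop (𝓝 1) := by
  have hi : MeasureTheory.IntegrableOn (fun y : ℝ => Real.exp (-y ^ 2)) (Ioi 0) := by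
    have := (integrable_exp_neg_mul_sq (b := 1) one_pos).integrableOn (s := Ioi 0)
    simpa using this
  have h := MeasureTheory.intervalIntegral_tendsto_integral_Ioi 0 hi tendsto_id
  have hv : ∫ y in Ioi (0:ℝ), Real.exp (-y ^ 2) = Real.sqrt Real.pi / 2 := by
    have := integral_gaussian_Ioi 1
    simpa using this
  rw [hv] at h
  have := (h.div_const (Real.sqrt Real.pi)).const_add (1 / 2)
  have e : 1 / 2 + Real.sqrt Real.pi / 2 / Real.sqrt Real.pi = 1 := by
    have := sqrtpi_pos
    field_simp; norm_num
  rw [e] at this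
  exact this

theorem Nf_le_one (z : ℝ) : Nf z ≤ 1 := Nf_mono.ge_of_tendsto Nf_tendsto z

theorem Nf_nonneg (z : ℝ) : 0 ≤ Nf z := by
  have := Nf_le_one (-z)
  rw [Nf_neg] at this; linarith

/-- Tail function with parameter. -/
theorem tail_hasDerivAt (c z : ℝ) (hz : 0 < z) :
    HasDerivAt (fun z => Nf z + c * (Real.exp (-z ^ 2) / z))
      (Real.exp (-z ^ 2) * (1 / Real.sqrt Real.pi - c * (2 + 1 / z ^ 2))) z := by
  have := (hasDerivAt_Nf z).add
    ((((hasDerivAt_expsq z).div (hasDerivAt_id z) hz.ne')).const_mul c)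
  refine this.congr_deriv ?_
  have := sqrtpi_pos
  simp only [id]
  field_simp
  ring

theorem tail_tendsto (c : ℝ) :
    Tendsto (fun z => Nf z + c * (Real.exp (-z ^ 2) / z)) atTop (𝓝 1) := by
  have h : Tendsto (fun z : ℝ => Real.exp (-z ^ 2) / z) atTop (𝓝 0) := by
    refine squeeze_zero' (g := fun z : ℝ => z⁻¹) ?_ ?_ tendsto_inv_atTop_zero
    · filter_upwards [eventually_gt_atTop 0] with z hz
      positivity
    · filter_upwards [eventually_gt_atTop 0] with z hz
      rw [div_eq_mul_inv]
      have : Real.exp (-z ^ 2) ≤ 1 := Real.exp_le_one_iff.2 (by nlinarith)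
      have : 0 < z⁻¹ := by positivity
      nlinarith
  simpa using Nf_tendsto.add (h.const_mul c)

theorem tail_ge (z : ℝ) (hz : 0 < z) :
    1 ≤ Nf z + 1 / (2 * Real.sqrt Real.pi) * (Real.exp (-z ^ 2) / z) := by
  have hd := fun y (hy : 0 < y) => tail_hasDerivAt (1 / (2 * Real.sqrt Real.pi)) y hy
  have hanti : AntitoneOn (fun z => Nf z + 1 / (2 * Real.sqrt Real.pi) *
      (Real.exp (-z ^ 2) / z)) (Ioi 0) := by
    refine antitoneOn_of_deriv_nonpos (convex_Ioi 0)
      (fun y hy => (hd y hy).continuousAt.continuousWithinAt)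
      (fun y hy => (hd y (by simpa using hy)).differentiableAt.differentiableWithinAt) ?_
    intro y hy
    have hy : 0 < y := by simpa using hy
    rw [(hd y hy).deriv]
    refine mul_nonpos_of_nonneg_of_nonpos (Real.exp_pos _).le ?_
    have := sqrtpi_pos
    have e : 1 / Real.sqrt Real.pi - 1 / (2 * Real.sqrt Real.pi) * (2 + 1 / y ^ 2) =
      - (1 / (2 * Real.sqrt Real.pi) * (1 / y ^ 2)) := by field_simp; ring
    rw [e]
    have : 0 < 1 / (2 * Real.sqrt Real.pi) * (1 / y ^ 2) := by positivity
    linarith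
  refine le_of_tendsto (tail_tendsto (1 / (2 * Real.sqrt Real.pi))) ?_
  filter_upwards [eventually_ge_atTop z] with y hy
  exact hanti hz (hz.trans_le hy) hy

theorem tail_le : Nf 1 + 1 / (4 * Real.sqrt Real.pi) * Real.exp (-1) ≤ 1 := by
  have hd := fun y (hy : 0 < y) => tail_hasDerivAt (1 / (4 * Real.sqrt Real.pi)) y hy
  have hmono : MonotoneOn (fun z => Nf z + 1 / (4 * Real.sqrt Real.pi) *
      (Real.exp (-z ^ 2) / z)) (Ici 1) := by
    refine monotoneOn_of_deriv_nonneg (convex_Ici 1)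
      (fun y hy => (hd y (zero_lt_one.trans_le hy)).continuousAt.continuousWithinAt)
      (fun y hy => (hd y (zero_lt_one.trans (by simpa using hy))).differentiableAt.differentiableWithinAt) ?_
    intro y hy
    have hy : 1 < y := by simpa using hy
    rw [(hd y (by linarith)).deriv]
    refine mul_nonneg (Real.exp_pos _).le ?_
    have := sqrtpi_pos
    have e : 1 / Real.sqrt Real.pi - 1 / (4 * Real.sqrt Real.pi) * (2 + 1 / y ^ 2) =
      1 / (4 * Real.sqrt Real.pi) * (2 - 1 / y ^ 2) := by field_simp; ring
    rw [e]
    have : 1 / y ^ 2 ≤ 1 := by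
      rw [div_le_one (by positivity)]; nlinarith
    have : 0 < 1 / (4 * Real.sqrt Real.pi) := by positivity
    nlinarith
  have : (fun z => Nf z + 1 / (4 * Real.sqrt Real.pi) * (Real.exp (-z ^ 2) / z)) 1 ≤ 1 := by
    refine ge_of_tendsto (tail_tendsto (1 / (4 * Real.sqrt Real.pi))) ?_
    filter_upwards [eventually_ge_atTop 1] with y hy
    exact hmono self_mem_Ici hy hy
  simpa using this

theorem kf_neg (z : ℝ) : kf (-z) = kf z - z := by
  unfold kf
  rw [Nf_neg, neg_sq]; ring

theorem kf_zero : kf 0 = 1 / (2 * Real.sqrt Real.pi) := by simp [kf]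

theorem kf_mono : Monotone kf := by
  refine monotone_of_deriv_nonneg (fun z => (hasDerivAt_kf z).differentiableAt) fun z => ?_
  rw [(hasDerivAt_kf z).deriv]; exact Nf_nonneg z

theorem kf_ge_self (z : ℝ) : z ≤ kf z := by
  by_cases hz : 0 < z
  · have h := tail_ge z hz
    have e : kf z - z = z * (Nf z + 1 / (2 * Real.sqrt Real.pi) * (Real.exp (-z ^ 2) / z) - 1) := by
      unfold kf
      have := sqrtpi_pos
      field_simp
    have : 0 ≤ z * (Nf z + 1 / (2 * Real.sqrt Real.pi) * (Real.exp (-z ^ 2) / z) - 1) :=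
      mul_nonneg hz.le (by linarith)
    linarith
  · have h1 := Nf_le_one z
    have : 0 ≤ Real.exp (-z ^ 2) / (2 * Real.sqrt Real.pi) := by positivity
    unfold kf
    nlinarith

theorem kf_nonneg (z : ℝ) : 0 ≤ kf z := by
  have := kf_ge_self (-z)
  rw [kf_neg] at this; linarith

theorem kf_sub_le {a b : ℝ} (h : a ≤ b) : kf b - kf a ≤ b - a := by
  have hm : Antitone (fun z => kf z - z) := by
    have hd := fun z => (hasDerivAt_kf z).sub (hasDerivAt_id z)
    refine antitone_of_deriv_nonpos (fun z => (hd z).differentiableAt) fun z => ?_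
    have := (hd z).deriv
    have h2 : deriv (fun z => kf z - z) z = Nf z - 1 := this
    rw [h2]; linarith [Nf_le_one z]
  have := hm h
  simp only at this
  linarith

theorem kf_le_max (z : ℝ) : kf z ≤ max z 0 + kf 0 := by
  rcases le_total z 0 with h | h
  · rw [max_eq_right h]; linarith [kf_mono h]
  · rw [max_eq_left h]; linarith [kf_sub_le h]

theorem kf_neg_one : 2 * kf (-1) ≤ 1 / (2 * Real.sqrt Real.pi) * Real.exp (-1) := by
  have h := tail_le
  rw [kf_neg]
  have e : kf 1 = Nf 1 + 2 * (1 / (4 * Real.sqrt Real.pi) * Real.exp (-1)) := by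
    unfold kf
    have := sqrtpi_pos
    norm_num
    field_simp
    ring
  have e2 : 1 / (2 * Real.sqrt Real.pi) * Real.exp (-1) =
      2 * (1 / (4 * Real.sqrt Real.pi) * Real.exp (-1)) := by
    have := sqrtpi_pos
    field_simp
    ring
  rw [e, e2]; linarith

/-- scaled profile -/
def Kf (r s : ℝ) : ℝ := r * kf (s / r)

theorem Kf_nonneg {r : ℝ} (hr : 0 < r) (s : ℝ) : 0 ≤ Kf r s := mul_nonneg hr.le (kf_nonneg _)

theorem Kf_ge_self {r : ℝ} (hr : 0 < r) (s : ℝ) : s ≤ Kf r s := by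
  have := mul_le_mul_of_nonneg_left (kf_ge_self (s / r)) hr.le
  rwa [mul_div_cancel₀ _ hr.ne'] at this

theorem Kf_le {r : ℝ} (hr : 0 < r) (s : ℝ) : Kf r s ≤ max s 0 + r * kf 0 := by
  have := mul_le_mul_of_nonneg_left (kf_le_max (s / r)) hr.le
  rw [mul_add, mul_max_of_nonneg _ _ hr.le, mul_div_cancel₀ _ hr.ne', mul_zero] at this
  exact this

theorem Kf_sub_le {r : ℝ} (hr : 0 < r) (s : ℝ) : Kf r s - Kf r (s - 1) ≤ 1 := by
  have h : (s - 1) / r ≤ s / r := by gcongr; linarith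
  have := mul_le_mul_of_nonneg_left (kf_sub_le h) hr.le
  have e : r * (s / r - (s - 1) / r) = 1 := by field_simp; ring
  rw [e] at this
  unfold Kf; linarith

theorem hasDerivAt_Kf_space {r : ℝ} (hr : 0 < r) (c x : ℝ) :
    HasDerivAt (fun ξ => Kf r (ξ + c)) (Nf ((x + c) / r)) x := by
  have h1 : HasDerivAt (fun ξ : ℝ => (ξ + c) / r) (1 / r) x :=
    ((hasDerivAt_id x).add_const c).div_const r
  have := ((hasDerivAt_kf ((x + c) / r)).comp x h1).const_mul r
  refine this.congr_deriv ?_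
  field_simp

theorem hasDerivAt_Nf_space {r : ℝ} (c x : ℝ) :
    HasDerivAt (fun ξ => Nf ((ξ + c) / r))
      (Real.exp (-((x + c) / r) ^ 2) / Real.sqrt Real.pi * (1 / r)) x := by
  have h1 : HasDerivAt (fun ξ : ℝ => (ξ + c) / r) (1 / r) x :=
    ((hasDerivAt_id x).add_const c).div_const r
  exact HasDerivAt.comp (h₂ := Nf) x (hasDerivAt_Nf ((x + c) / r)) h1

theorem hasDerivAt_Kf_time {r : ℝ → ℝ} {r' t : ℝ} (hr : 0 < r t) (hr' : HasDerivAt r r' t)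
    (c : ℝ) :
    HasDerivAt (fun τ => Kf (r τ) (c - τ))
      (- Nf ((c - t) / r t) +
        r' * (Real.exp (-((c - t) / r t) ^ 2) / (2 * Real.sqrt Real.pi))) t := by
  have h1 : HasDerivAt (fun τ : ℝ => (c - τ) / r τ) ((-1 * r t - (c - t) * r') / r t ^ 2) t :=
    HasDerivAt.div ((hasDerivAt_id t).const_sub c) hr' hr.ne'
  have := hr'.mul ((hasDerivAt_kf ((c - t) / r t)).comp t h1)
  refine this.congr_deriv ?_
  have hp := sqrtpi_pos
  simp only [Function.comp]
  unfold kf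
  field_simp
  ring

/-- smooth positive extension of `t + δ` -/
def sg (δ t : ℝ) : ℝ := δ / 2 + (t + δ / 2) * Real.smoothTransition (1 + 2 * t / δ)

theorem sg_pos {δ : ℝ} (hδ : 0 < δ) (t : ℝ) : 0 < sg δ t := by
  unfold sg
  rcases le_total (1 + 2 * t / δ) 0 with h | h
  · rw [Real.smoothTransition.zero_of_nonpos h]; linarith
  · have h1 : 0 ≤ t + δ / 2 := by
      have : 0 ≤ δ / 2 * (1 + 2 * t / δ) := by positivity
      have e : δ / 2 * (1 + 2 * t / δ) = t + δ / 2 := by field_simp; ring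
      linarith
    have := mul_nonneg h1 (Real.smoothTransition.nonneg (1 + 2 * t / δ))
    linarith

theorem sg_eq {δ : ℝ} (hδ : 0 < δ) {t : ℝ} (ht : 0 ≤ t) : sg δ t = t + δ := by
  unfold sg
  rw [Real.smoothTransition.one_of_one_le]
  · ring
  · have : 0 ≤ 2 * t / δ := by positivity
    linarith

theorem sg_contDiff (δ : ℝ) : ContDiff ℝ 2 (sg δ) := by
  have : ContDiff ℝ 2 Real.smoothTransition := Real.smoothTransition.contDiff
  unfold sg
  fun_prop

/-- The radius. -/
def rad (ε δ t : ℝ) : ℝ := Real.sqrt (4 * ε * sg δ t)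

theorem rad_pos {ε δ : ℝ} (hε : 0 < ε) (hδ : 0 < δ) (t : ℝ) : 0 < rad ε δ t :=
  Real.sqrt_pos.2 (by have := sg_pos hδ t; positivity)

theorem rad_contDiff {ε δ : ℝ} (hε : 0 < ε) (hδ : 0 < δ) : ContDiff ℝ 2 (rad ε δ) := by
  unfold rad
  exact ContDiff.sqrt (contDiff_const.mul (sg_contDiff δ))
    (fun t => by have := sg_pos hδ t; positivity)

theorem rad_hasDerivAt {ε δ t : ℝ} (hε : 0 < ε) (hδ : 0 < δ) (ht : 0 < t) :
    HasDerivAt (rad ε δ) (2 * ε / rad ε δ t) t := by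
  have h1 : HasDerivAt (sg δ) 1 t := by
    refine ((hasDerivAt_id t).add_const δ).congr_of_eventuallyEq ?_
    filter_upwards [lt_mem_nhds ht] with y hy
    exact sg_eq hδ (le_of_lt hy)
  have := (h1.const_mul (4 * ε)).sqrt (by have := sg_pos hδ t; positivity)
  refine this.congr_deriv ?_
  have h2 := rad_pos hε hδ t
  change 4 * ε * 1 / (2 * rad ε δ t) = _
  field_simp
  ring

theorem upper_bound (F : ℝ → ℝ) (hF : Continuous F)
    (hF1 : ∀ p ∈ Icc (0:ℝ) 1, F p = p)
    (g : ℝ → ℝ) (hg : ∀ x : ℝ, g x = max (1 - |x|) 0) (u : ℝ × ℝ → ℝ)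
    (hu : IsViscositySolutionCauchy F 0 g u) (r : ℝ) (hr : 0 < r) : u (0, 1) ≤ r * kf 0 := by
  obtain ⟨⟨M, hM⟩, huc, hsub, -, hu0⟩ := hu
  set v : ℝ × ℝ → ℝ := fun p => Kf r (p.1 + 1 - p.2) with hv
  have hvC : ContDiff ℝ 2 v := by
    have := contDiff_kf
    simp only [hv, Kf]; fun_prop
  have hX : ∀ t : ℝ, deriv (fun ξ => v (ξ, t)) = fun x => Nf ((x + (1 - t)) / r) := by
    intro t; funext x
    have := (hasDerivAt_Kf_space hr (1 - t) x).deriv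
    simpa only [hv, add_sub_assoc] using this
  have hT : ∀ x t : ℝ, deriv (fun τ => v (x, τ)) t = - Nf ((x + (1 - t)) / r) := by
    intro x t
    have := (hasDerivAt_Kf_time (r := fun _ => r) hr (hasDerivAt_const t r) (x + 1)).deriv
    simpa only [hv, add_sub_assoc, zero_mul, add_zero] using this
  have key := sub_comparison F hF 0 le_rfl u v M ?_ huc.continuousOn hsub hvC ?_ ?_ ?_ 0 1 one_pos
  · simpa [hv, Kf] using key
  · intro p _
    have h1 := Kf_nonneg hr (p.1 + 1 - p.2)
    have h2 := (abs_le.1 (hM p)).2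
    simp only [hv]; linarith
  · intro x
    rw [hu0, hg]
    simp only [hv, sub_zero]
    refine max_le ?_ (Kf_nonneg hr _)
    have := Kf_ge_self hr (x + 1)
    linarith [neg_abs_le x]
  · intro x t _
    rw [hX]
    exact ⟨by linarith [Nf_nonneg ((x + (1 - t)) / r)], Nf_le_one _⟩
  · intro x t _
    rw [hX, hT, hF1 _ ⟨Nf_nonneg _, Nf_le_one _⟩]
    simp

theorem lower_bound (F : ℝ → ℝ) (hF : Continuous F)
    (hF3 : ∀ p ∈ Icc (-1:ℝ) 1, F p ≤ p)
    (g : ℝ → ℝ) (hg : ∀ x : ℝ, g x = max (1 - |x|) 0)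
    (ε : ℝ) (hε : 0 < ε) (u : ℝ × ℝ → ℝ)
    (hu : IsViscositySolutionCauchy F ε g u) (δ : ℝ) (hδ : 0 < δ) :
    Kf (Real.sqrt (4 * ε * (1 + δ))) 0 - 2 * Kf (Real.sqrt (4 * ε * (1 + δ))) (-1)
      - Real.sqrt (4 * ε * δ) * kf 0 ≤ u (0, 1) := by
  obtain ⟨⟨M, hM⟩, huc, -, hsup, hu0⟩ := hu
  have hk0 := kf_nonneg 0
  set c := Real.sqrt (4 * ε * δ) * kf 0 with hc
  have hcn : 0 ≤ c := by positivity
  have hR := rad_pos hε hδ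
  set v : ℝ × ℝ → ℝ := fun p => Kf (rad ε δ p.2) (p.1 + 1 - p.2) -
    2 * Kf (rad ε δ p.2) (p.1 - p.2) - c with hv
  have hvC : ContDiff ℝ 2 v := by
    have h1 := contDiff_kf
    have h2 := rad_contDiff hε hδ
    have h3 : ContDiff ℝ 2 (fun p : ℝ × ℝ => rad ε δ p.2) := by fun_prop
    have h4 : ∀ f : ℝ × ℝ → ℝ, ContDiff ℝ 2 f →
        ContDiff ℝ 2 (fun p : ℝ × ℝ => Kf (rad ε δ p.2) (f p)) := fun f hf =>
      h3.mul (h1.comp (hf.div h3 (fun p => (hR p.2).ne')))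
    exact ((h4 _ (by fun_prop)).sub (contDiff_const.mul (h4 _ (by fun_prop)))).sub contDiff_const
  have hX : ∀ t : ℝ, deriv (fun ξ => v (ξ, t)) =
      fun x => Nf ((x + (1 - t)) / rad ε δ t) - 2 * Nf ((x + (- t)) / rad ε δ t) := by
    intro t; funext x
    have := (((hasDerivAt_Kf_space (hR t) (1 - t) x).sub
      ((hasDerivAt_Kf_space (hR t) (- t) x).const_mul 2)).sub_const c).deriv
    rw [← this]
    congr 1
    funext ξ
    simp only [hv, Pi.sub_apply]
    congr 3
    ring
  have hXX : ∀ x t : ℝ, deriv (deriv (fun ξ => v (ξ, t))) x =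
      Real.exp (-((x + (1 - t)) / rad ε δ t) ^ 2) / Real.sqrt Real.pi * (1 / rad ε δ t) -
      2 * (Real.exp (-((x + (- t)) / rad ε δ t) ^ 2) / Real.sqrt Real.pi * (1 / rad ε δ t)) := by
    intro x t
    rw [hX]
    exact ((hasDerivAt_Nf_space (1 - t) x).sub
      ((hasDerivAt_Nf_space (- t) x).const_mul 2)).deriv
  have hT : ∀ x t : ℝ, 0 < t → deriv (fun τ => v (x, τ)) t =
      - (Nf ((x + (1 - t)) / rad ε δ t) - 2 * Nf ((x + (- t)) / rad ε δ t)) +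
      ε * deriv (deriv (fun ξ => v (ξ, t))) x := by
    intro x t ht
    have hr' := rad_hasDerivAt hε hδ ht
    have := (((hasDerivAt_Kf_time (hR t) hr' (x + 1)).sub
      ((hasDerivAt_Kf_time (hR t) hr' x).const_mul 2)).sub_const c).deriv
    rw [hXX]
    refine Eq.trans this ?_
    have e1 : x + 1 - t = x + (1 - t) := by ring
    have e2 : x - t = x + (- t) := by ring
    rw [e1, e2]
    have := sqrtpi_pos
    have := hR t
    field_simp
    ring
  have hslope : ∀ x t : ℝ, Nf ((x + (1 - t)) / rad ε δ t) - 2 * Nf ((x + (- t)) / rad ε δ t)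
      ∈ Icc (-1:ℝ) 1 := by
    intro x t
    have h1 := Nf_le_one ((x + (1 - t)) / rad ε δ t)
    have h2 := Nf_nonneg ((x + (- t)) / rad ε δ t)
    have h3 := Nf_le_one ((x + (- t)) / rad ε δ t)
    have h4 : Nf ((x + (- t)) / rad ε δ t) ≤ Nf ((x + (1 - t)) / rad ε δ t) := by
      apply Nf_mono
      have := hR t
      gcongr
      linarith
    exact ⟨by linarith, by linarith⟩
  have key := super_comparison F hF ε hε.le u v (1 + M) ?_ huc.continuousOn hsup hvC ?_ ?_ ?_
    0 1 one_pos
  · simpa [hv, rad, sg_eq hδ zero_le_one] using key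
  · intro p _
    have h1 := Kf_sub_le (hR p.2) (p.1 + 1 - p.2)
    have h2 := (abs_le.1 (hM p)).1
    have h3 := Kf_nonneg (hR p.2) (p.1 - p.2)
    have e : p.1 + 1 - p.2 - 1 = p.1 - p.2 := by ring
    rw [e] at h1
    simp only [hv]; linarith
  · intro x
    rw [hu0, hg]
    have hr0 : rad ε δ 0 = Real.sqrt (4 * ε * δ) := by simp [rad, sg_eq hδ le_rfl]
    have h1 := Kf_le (hR 0) (x + 1)
    have h2 := Kf_nonneg (hR 0) x
    have h3 := Kf_ge_self (hR 0) x
    rw [hr0] at h1 h2 h3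
    simp only [hv, sub_zero, hr0]
    rcases le_total (x + 1) 0 with h | h
    · rw [max_eq_right h] at h1
      exact le_max_of_le_right (by linarith)
    · rw [max_eq_left h] at h1
      refine le_max_of_le_left ?_
      rcases le_total x 0 with h | h
      · rw [abs_of_nonpos h]; linarith
      · rw [abs_of_nonneg h]; linarith
  · intro x t _
    rw [hX]; exact hslope x t
  · intro x t ht
    rw [hT x t ht, hX]
    have := hF3 _ (hslope x t)
    linarith

/-- If `F` is locally Lipschitz with `F(p) = p` on `[0,1]` and `F(p) ≤ p`
on `[-1,0]`, and `g(x) = max{1-|x|,0}`, then for `ε ∈ (0,1/4)` the viscosity solutions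
`u^ε` of `u_t + F(u_x) = ε u_xx` and `u` of `u_t + F(u_x) = 0` with initial datum `g`
satisfy `|u^ε(0,1) - u(0,1)| ≥ ((e-1)/(√π e)) √ε`. -/
theorem statement1
    (F : ℝ → ℝ) (hF : LocallyLipschitz F)
    (hF1 : ∀ p ∈ Set.Icc (0:ℝ) 1, F p = p)
    (hF2 : ∀ p ∈ Set.Icc (-1:ℝ) 0, F p ≤ p)
    (g : ℝ → ℝ) (hg : ∀ x : ℝ, g x = max (1 - |x|) 0)
    (ε : ℝ) (hε : ε ∈ Set.Ioo (0:ℝ) (1/4))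
    (uε u : ℝ × ℝ → ℝ)
    (huε : IsViscositySolutionCauchy F ε g uε)
    (hu : IsViscositySolutionCauchy F 0 g u) :
    (Real.exp 1 - 1) / (Real.sqrt Real.pi * Real.exp 1) * Real.sqrt ε
      ≤ |uε (0, 1) - u (0, 1)| := by
  have hFc : Continuous F := hF.continuous
  have hupper : u (0, 1) ≤ 0 := by
    have h : ∀ r : ℝ, 0 < r → u (0, 1) ≤ r * kf 0 := upper_bound F hFc hF1 g hg u hu
    have ht : Tendsto (fun r : ℝ => r * kf 0) (𝓝[>] 0) (𝓝 (0 * kf 0)) :=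
      (Continuous.tendsto (by fun_prop) 0).mono_left nhdsWithin_le_nhds
    rw [zero_mul] at ht
    refine ge_of_tendsto ht ?_
    filter_upwards [self_mem_nhdsWithin] with r hr
    exact h r hr
  have hF3 : ∀ p ∈ Icc (-1:ℝ) 1, F p ≤ p := by
    intro p hp
    rcases le_total p 0 with h | h
    · exact hF2 p ⟨hp.1, h⟩
    · exact (hF1 p ⟨h, hp.2⟩).le
  have hε0 : 0 < ε := hε.1
  have hlower : Kf (Real.sqrt (4 * ε)) 0 - 2 * Kf (Real.sqrt (4 * ε)) (-1) ≤ uε (0, 1) := by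
    have h := lower_bound F hFc hF3 g hg ε hε0 uε huε
    have hk : Continuous kf := contDiff_kf.continuous
    have ht : Tendsto (fun δ : ℝ => Kf (Real.sqrt (4 * ε * (1 + δ))) 0
        - 2 * Kf (Real.sqrt (4 * ε * (1 + δ))) (-1) - Real.sqrt (4 * ε * δ) * kf 0) (𝓝[>] 0)
        (𝓝 (Kf (Real.sqrt (4 * ε * (1 + 0))) 0
        - 2 * Kf (Real.sqrt (4 * ε * (1 + 0))) (-1) - Real.sqrt (4 * ε * 0) * kf 0)) := by
      refine Tendsto.mono_left (ContinuousAt.tendsto ?_) nhdsWithin_le_nhds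
      have hs : ContinuousAt (fun δ : ℝ => Real.sqrt (4 * ε * (1 + δ))) 0 :=
        Continuous.continuousAt (by fun_prop)
      have hs0 : Real.sqrt (4 * ε * (1 + 0)) ≠ 0 := (Real.sqrt_pos.2 (by linarith)).ne'
      have hK : ∀ s : ℝ, ContinuousAt (fun δ : ℝ => Kf (Real.sqrt (4 * ε * (1 + δ))) s) 0 :=
        fun s => hs.mul (hk.continuousAt.comp (continuousAt_const.div hs hs0))
      exact ((hK 0).sub (continuousAt_const.mul (hK (-1)))).sub
        (Continuous.continuousAt (by fun_prop))
    simp only [add_zero, mul_one, mul_zero, Real.sqrt_zero, zero_mul, sub_zero] at ht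
    refine le_of_tendsto ht ?_
    filter_upwards [self_mem_nhdsWithin] with δ hδ
    exact h δ hδ
  have hr : Real.sqrt (4 * ε) = 2 * Real.sqrt ε := by
    rw [Real.sqrt_mul (by norm_num), show (4:ℝ) = 2 ^ 2 by norm_num,
      Real.sqrt_sq (by norm_num)]
  have hse : 0 < Real.sqrt ε := Real.sqrt_pos.2 hε0
  have hse2 : 2 * Real.sqrt ε ≤ 1 := by
    have h1 := Real.sq_sqrt hε0.le
    have h2 := hε.2
    nlinarith
  rw [hr] at hlower
  have hK1 : kf (-1 / (2 * Real.sqrt ε)) ≤ kf (-1) := by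
    apply kf_mono
    rw [div_le_iff₀ (by positivity)]
    linarith
  have hk1 := kf_neg_one
  have hb : 2 * Real.sqrt ε * (kf 0 - 1 / (2 * Real.sqrt Real.pi) * Real.exp (-1))
      ≤ uε (0, 1) := by
    refine le_trans ?_ hlower
    unfold Kf
    rw [zero_div]
    have : 2 * Real.sqrt ε * (2 * kf (-1 / (2 * Real.sqrt ε))) ≤
      2 * Real.sqrt ε * (1 / (2 * Real.sqrt Real.pi) * Real.exp (-1)) :=
      mul_le_mul_of_nonneg_left (by linarith) (by positivity)
    linarith
  have e : (Real.exp 1 - 1) / (Real.sqrt Real.pi * Real.exp 1) * Real.sqrt ε =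
      2 * Real.sqrt ε * (kf 0 - 1 / (2 * Real.sqrt Real.pi) * Real.exp (-1)) := by
    rw [kf_zero, Real.exp_neg]
    have := sqrtpi_pos
    have := Real.exp_pos 1
    field_simp
  rw [e]
  refine le_trans ?_ (le_abs_self _)
  linarith
end
end

section
/- Let n = 1. Let F ∈ Lip_loc(ℝ) be linear on some open interval (a,b) ⊂ ℝ with a < b. Then there exist an initial datum g ∈ Lip(ℝ) with ‖g‖_{C^{0,1}(ℝ)} < ∞ and a constant c₀ > 0 (depending only on F and g) such that for every ε ∈ (0, 1/4), if u^ε is a bounded uniformly continuous viscosity solution of u_t + F(u_x) = ε u_xx in ℝ×(0,∞) with u^ε(·,0) = g, and u is a bounded uniformly continuous viscosity solution of u_t + F(u_x) = 0 in ℝ×(0,∞) with u(·,0) = g, then |u^ε(0,1) − u(0,1)| ≥ c₀ √ε. -/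
noncomputable section

lemma aux_compare (F : ℝ → ℝ) (ε : ℝ) (w φ : ℝ × ℝ → ℝ) (R : ℝ) (hR : 0 < R)
    (hc : UniformContinuousOn w {p : ℝ × ℝ | 0 ≤ p.2})
    (hsub : IsViscositySubsolution F ε w) (hφ : ContDiff ℝ 2 φ)
    (h0 : ∀ x, w (x, 0) ≤ φ (x, 0))
    (h2 : ∀ x, w (x, 2) ≤ φ (x, 2))
    (hs : ∀ x t, 0 ≤ t → t ≤ 2 → |x| = R → w (x, t) ≤ φ (x, t))
    (hstrict : ∀ x t, 0 < t → ε * deriv (deriv (fun ξ => φ (ξ, t))) x <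
      deriv (fun τ => φ (x, τ)) t + F (deriv (fun ξ => φ (ξ, t)) x)) :
    w (0, 1) ≤ φ (0, 1) := by
  set K : Set (ℝ × ℝ) := Set.Icc (-R) R ×ˢ Set.Icc 0 2 with hK
  have hKc : IsCompact K := isCompact_Icc.prod isCompact_Icc
  have h01 : ((0 : ℝ), (1 : ℝ)) ∈ K := by
    simp only [hK, Set.mem_prod, Set.mem_Icc]
    refine ⟨⟨by linarith, by linarith⟩, by norm_num, by norm_num⟩
  have hcont : ContinuousOn (fun p => w p - φ p) K := by
    apply ContinuousOn.sub
    · apply hc.continuousOn.mono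
      rintro ⟨x, t⟩ hx
      exact hx.2.1
    · exact hφ.continuous.continuousOn
  obtain ⟨⟨x, t⟩, hm, hmax⟩ := hKc.exists_isMaxOn ⟨_, h01⟩ hcont
  have hb := hmax h01
  simp only [Set.mem_ofPred_eq] at hb
  by_cases hle : w (x, t) ≤ φ (x, t)
  · linarith
  exfalso
  obtain ⟨⟨hx1, hx2⟩, ht1, ht2⟩ := hm
  simp only at hx1 hx2 ht1 ht2
  have ht1' : 0 < t := by
    rcases ht1.lt_or_eq with h | h
    · exact h
    · subst h; exact absurd (h0 x) hle
  have ht2' : t < 2 := by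
    rcases ht2.lt_or_eq with h | h
    · exact h
    · subst h; exact absurd (h2 x) hle
  have hx : |x| < R := by
    rcases (abs_le.2 ⟨hx1, hx2⟩).lt_or_eq with h | h
    · exact h
    · exact absurd (hs x t ht1 ht2 h) hle
  rw [abs_lt] at hx
  have hn : K ∈ nhds (x, t) := prod_mem_nhds (Icc_mem_nhds hx.1 hx.2) (Icc_mem_nhds ht1' ht2')
  have hl : IsLocalMax (fun p => w p - φ p) (x, t) := hmax.isLocalMax hn
  exact absurd (hsub φ hφ x t ht1' hl) (not_le.2 (hstrict x t ht1'))

def rr (η s : ℝ) : ℝ := Real.sqrt (s ^ 2 + η ^ 2)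

lemma rr_pos {η : ℝ} (hη : 0 < η) (s : ℝ) : 0 < rr η s := Real.sqrt_pos.2 (by positivity)

lemma rr_sq (η s : ℝ) : rr η s ^ 2 = s ^ 2 + η ^ 2 := Real.sq_sqrt (by positivity)

lemma rr_abs (η s : ℝ) : |s| ≤ rr η s := Real.abs_le_sqrt (by nlinarith [sq_nonneg η])

lemma rr_ge {η : ℝ} (hη : 0 < η) (s : ℝ) : η ≤ rr η s :=
  Real.le_sqrt_of_sq_le (by nlinarith [sq_nonneg s])

lemma rr_le {η : ℝ} (hη : 0 < η) (s : ℝ) : rr η s ≤ |s| + η := by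
  apply Real.sqrt_le_iff.2
  refine ⟨by positivity, ?_⟩
  nlinarith [sq_abs s, abs_nonneg s, mul_nonneg (abs_nonneg s) hη.le]

lemma rr_contDiff {η : ℝ} (hη : 0 < η) : ContDiff ℝ 2 (rr η) := by
  unfold rr
  apply ContDiff.sqrt (by fun_prop)
  intro x
  positivity

lemma rr_deriv {η : ℝ} (hη : 0 < η) (s : ℝ) : HasDerivAt (rr η) (s / rr η s) s := by
  have h : HasDerivAt (fun s : ℝ => s ^ 2 + η ^ 2) (2 * s) s := by
    simpa using (hasDerivAt_pow 2 s).add_const (η ^ 2)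
  have h2 := h.sqrt (by positivity)
  refine HasDerivAt.congr_deriv h2 ?_
  unfold rr
  rw [mul_div_mul_left _ _ two_ne_zero]

lemma rr_deriv2 {η : ℝ} (hη : 0 < η) (s : ℝ) :
    HasDerivAt (fun s => s / rr η s) (η ^ 2 / rr η s ^ 3) s := by
  have hp := rr_pos hη s
  have h := (hasDerivAt_id s).div (rr_deriv hη s) hp.ne'
  refine HasDerivAt.congr_deriv h ?_
  have := rr_sq η s
  simp only [id]
  field_simp
  linarith

lemma rr_abs1 {η : ℝ} (hη : 0 < η) (s : ℝ) : |s / rr η s| ≤ 1 := by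
  rw [abs_div, abs_of_pos (rr_pos hη s), div_le_one (rr_pos hη s)]
  exact rr_abs η s

/-- The second derivative of the penalty is controlled by the first one. -/
lemma rr_key {η : ℝ} (hη : 0 < η) (s : ℝ) :
    η * (η ^ 2 / rr η s ^ 3 / 2) ≤ 2 * ((1 + s / rr η s) / 2) := by
  have hp := rr_pos hη s
  have h1 := rr_ge hη s
  have h2 := rr_sq η s
  have h3 := abs_le.1 (rr_abs η s)
  set r := rr η s
  have e1 : η * (η ^ 2 / r ^ 3 / 2) ≤ η ^ 2 / (2 * r ^ 2) := by
    rw [div_div, mul_div_assoc', div_le_div_iff₀ (by positivity) (by positivity)]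
    have : 0 ≤ η ^ 2 * r ^ 2 * (r - η) := mul_nonneg (by positivity) (by linarith)
    nlinarith
  have e2 : η ^ 2 / (2 * r ^ 2) ≤ 2 * ((1 + s / r) / 2) := by
    have : 2 * ((1 + s / r) / 2) = (r + s) / r := by field_simp
    rw [this, div_le_div_iff₀ (by positivity) hp]
    have h5 : η ^ 2 = (r + s) * (r - s) := by nlinarith
    have h4 : η ^ 2 ≤ (r + s) * (2 * r) := by
      rw [h5]
      exact mul_le_mul_of_nonneg_left (by linarith) (by linarith)
    nlinarith
  exact e1.trans e2

lemma rr_decay {η S : ℝ} (hη : 0 < η) (hS : 0 < S) :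
    (-S + rr η (-S)) / 2 ≤ η ^ 2 / (4 * S) := by
  have h2 := rr_sq η (-S)
  have h3 := (abs_le.1 (rr_abs η (-S))).1
  have hp := rr_pos hη (-S)
  rw [div_le_div_iff₀ (by norm_num) (by positivity)]
  nlinarith [sq_nonneg (rr η (-S) - S)]

lemma aux_alg (F : ℝ → ℝ) (ε η α β p₀ δ C LF L A1 A2 v v2 kk hy hyy ht' : ℝ)
    (hε : 0 ≤ ε) (hεη : ε ≤ η) (hη : 0 < η) (hη1 : η ≤ 1) (hCp : 0 < C) (hLF : 0 ≤ LF)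
    (hL : L = |α| + LF + 3)
    (hlin : ∀ q, |q - p₀| ≤ δ → F q = α * q + β)
    (hLip : ∀ p q, |p| ≤ |p₀| + δ + C → |q| ≤ |p₀| + δ + C → |F p - F q| ≤ LF * |p - q|)
    (q0 : 0 ≤ A1 ∧ A1 ≤ 1) (qk : η * A2 ≤ 2 * A1) (q2 : 0 ≤ A2) (hσ : |v| ≤ 1)
    (hσ2 : v2 ≤ 1) (hσ3 : 0 ≤ v2) (hHb' : |hy| ≤ δ) (hht : ε * hyy ≤ ht') (hk : 0 < kk) :
    ε * (hyy + C * (A2 * v ^ 2 + A1 * v2)) <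
      -α * p₀ + (ht' - α * hy) - β + kk + C * (A1 * (L - α * v)) +
        F (p₀ + hy + C * (A1 * v)) := by
  have hlq := hlin (p₀ + hy) (by simpa using hHb')
  have hA1v : |A1 * v| ≤ A1 := by
    rw [abs_mul, abs_of_nonneg q0.1]
    nlinarith
  have hq : |p₀ + hy| ≤ |p₀| + δ := (abs_add_le _ _).trans (by linarith)
  have hCv : |C * (A1 * v)| ≤ C * A1 := by
    rw [abs_mul, abs_of_pos hCp]
    exact mul_le_mul_of_nonneg_left hA1v hCp.le
  have hCA : C * A1 ≤ C := by nlinarith [q0.2]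
  have hl := hLip (p₀ + hy + C * (A1 * v)) (p₀ + hy)
    ((abs_add_le _ _).trans (by linarith)) (by linarith)
  have hl2 : LF * |p₀ + hy + C * (A1 * v) - (p₀ + hy)| ≤ LF * (C * A1) := by
    apply mul_le_mul_of_nonneg_left _ hLF
    simpa using hCv
  have hl3 := (abs_le.1 hl).1
  have hα : α * (C * (A1 * v)) ≤ |α| * (C * A1) := by
    refine (le_abs_self _).trans ?_
    rw [abs_mul]
    exact mul_le_mul_of_nonneg_left hCv (abs_nonneg _)
  have hα' : α * (C * (A1 * v)) ≤ |α| * (C * A1) := hα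
  have hv2 : v ^ 2 ≤ 1 := by
    rw [← sq_abs]; exact pow_le_one₀ (abs_nonneg _) hσ
  have t1 : ε * (A2 * v ^ 2) ≤ 2 * A1 := by
    have : ε * (A2 * v ^ 2) ≤ η * (A2 * 1) := by
      apply mul_le_mul hεη _ (by positivity) hη.le
      exact mul_le_mul_of_nonneg_left hv2 q2
    linarith
  have t2 : ε * (A1 * v2) ≤ A1 := by
    have : ε * (A1 * v2) ≤ 1 * (A1 * 1) := by
      apply mul_le_mul (hεη.trans hη1) _ (mul_nonneg q0.1 hσ3) zero_le_one
      exact mul_le_mul_of_nonneg_left hσ2 q0.1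
    linarith
  have t3 : C * (ε * (A2 * v ^ 2) + ε * (A1 * v2)) ≤ C * (3 * A1) :=
    mul_le_mul_of_nonneg_left (by linarith) hCp.le
  have t4 : C * (A1 * (L - α * v)) = |α| * (C * A1) + LF * (C * A1) + C * (3 * A1)
      - α * (C * (A1 * v)) := by rw [hL]; ring
  have t5 : ε * (hyy + C * (A2 * v ^ 2 + A1 * v2)) =
    ε * hyy + C * (ε * (A2 * v ^ 2) + ε * (A1 * v2)) := by ring
  rw [t4, t5]
  linarith

set_option maxHeartbeats 1000000 in
/-- The core barrier argument. -/
lemma aux_main (F : ℝ → ℝ) (ε η α β p₀ δ C LF S : ℝ) (w : ℝ × ℝ → ℝ) (H Hy Hyy Ht : ℝ → ℝ → ℝ)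
    (hε : 0 ≤ ε) (hεη : ε ≤ η) (hη : 0 < η) (hη1 : η ≤ 1) (hδ : 0 < δ)
    (hC : C = |p₀| + δ + 1) (hLF : 0 ≤ LF) (hS : 0 < S)
    (hlin : ∀ q, |q - p₀| ≤ δ → F q = α * q + β)
    (hLip : ∀ p q, |p| ≤ |p₀| + δ + C → |q| ≤ |p₀| + δ + C → |F p - F q| ≤ LF * |p - q|)
    (hH : ContDiff ℝ 2 (fun z : ℝ × ℝ => H z.1 z.2))
    (hHy : ∀ y t, HasDerivAt (fun y => H y t) (Hy y t) y)
    (hHyy : ∀ y t, HasDerivAt (fun y => Hy y t) (Hyy y t) y)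
    (hHt : ∀ x t, HasDerivAt (fun τ => H (x + α - α * τ) τ) 
      (Ht (x + α - α * t) t - α * Hy (x + α - α * t) t) t)
    (hheat : ∀ y t, 0 < t → ε * Hyy y t ≤ Ht y t)
    (hHyb : ∀ y t, 0 < t → |Hy y t| ≤ δ)
    (hHb : ∀ y t, 0 ≤ t → -(2 * δ) ≤ H y t)
    (hH0 : ∀ y, -(δ * |y|) ≤ H y 0)
    (hM : ∃ M, ∀ p, |w p| ≤ M)
    (hc : UniformContinuousOn w {p : ℝ × ℝ | 0 ≤ p.2})
    (hsub : IsViscositySubsolution F ε w)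
    (h0 : ∀ x, w (x, 0) ≤ 
      max (-(C * (1 + (|α| + LF + 3) + S))) (p₀ * (x + α) + H (x + α) 0)) :
    w (0, 1) ≤ H 0 1 - β + C * (η ^ 2 / (4 * S)) := by
  obtain ⟨M, hM⟩ := hM
  have hM0 : 0 ≤ M := (abs_nonneg _).trans (hM 0)
  have hCp : 0 < C := by rw [hC]; positivity
  set L := |α| + LF + 3 with hL
  have hLp : 0 < L := by positivity
  set s₀ := 1 + L + S with hs₀
  apply le_of_forall_pos_le_add
  intro κ hκ
  set D := C * s₀ + 2 * δ + 2 * |β| with hD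
  have hDp : 0 ≤ D := by positivity
  obtain ⟨N, hN⟩ : ∃ N : ℕ, D + M ≤ κ * 2 ^ (N + 1) := by
    obtain ⟨N, hN⟩ := pow_unbounded_of_one_lt ((D + M) / κ) (one_lt_two)
    refine ⟨N, ?_⟩
    rw [div_lt_iff₀ hκ] at hN
    have : (0:ℝ) < 2 ^ N := by positivity
    rw [pow_succ]
    nlinarith
  -- building blocks
  let Y : ℝ → ℝ → ℝ := fun x t => x + α - α * t
  let s : ℝ → ℝ → ℝ := fun x t => rr 1 (Y x t) + L * t - s₀
  let φ : ℝ × ℝ → ℝ := fun z => p₀ * (Y z.1 z.2) + H (Y z.1 z.2) z.2 - β * z.2 + κ * z.2 ^ (N + 1)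
    + C * ((s z.1 z.2 + rr η (s z.1 z.2)) / 2)
  have hYd : ContDiff ℝ 2 (fun z : ℝ × ℝ => Y z.1 z.2) := by
    simp only [Y]; fun_prop
  have hsd : ContDiff ℝ 2 (fun z : ℝ × ℝ => s z.1 z.2) := by
    have := (rr_contDiff one_pos).comp hYd
    simp only [Function.comp_def] at this
    simp only [s]
    exact (this.add (by fun_prop)).sub contDiff_const
  have hφ : ContDiff ℝ 2 φ := by
    have h1 := (rr_contDiff hη).comp hsd
    simp only [Function.comp_def] at h1
    have h2 := hH.comp (hYd.prodMk contDiff_snd)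
    simp only [Function.comp_def] at h2
    simp only [φ]
    exact ((((contDiff_const.mul hYd).add h2).sub (by fun_prop)).add (by fun_prop)).add
      (contDiff_const.mul ((hsd.add h1).div_const 2))
  -- spatial derivatives
  have hYx : ∀ x t, HasDerivAt (fun ξ => Y ξ t) 1 x := fun x t =>
    ((hasDerivAt_id x).add_const α).sub_const (α * t)
  have hYt : ∀ x t, HasDerivAt (fun τ => Y x τ) (-α) t := fun x t => by
    simpa using ((hasDerivAt_id t).const_mul α).const_sub (x + α)
  let σ : ℝ → ℝ → ℝ := fun x t => Y x t / rr 1 (Y x t)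
  have hsx : ∀ x t, HasDerivAt (fun ξ => s ξ t) (σ x t) x := fun x t => by
    have := (((rr_deriv one_pos (Y x t)).comp x (hYx x t)).add_const (L * t)).sub_const s₀
    simpa [σ, s, Function.comp_def] using this
  have hst : ∀ x t, HasDerivAt (fun τ => s x τ) (L - α * σ x t) t := fun x t => by
    have := (((rr_deriv one_pos (Y x t)).comp t (hYt x t)).add
      ((hasDerivAt_id t).const_mul L)).sub_const s₀
    refine HasDerivAt.congr_deriv this ?_
    simp only [σ]; ring
  have hσx : ∀ x t, HasDerivAt (fun ξ => σ ξ t) (1 / rr 1 (Y x t) ^ 3) x := fun x t => by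
    have := (rr_deriv2 one_pos (Y x t)).comp x (hYx x t)
    simpa [σ, Function.comp_def] using this
  let Q1 : ℝ → ℝ := fun s => (1 + s / rr η s) / 2
  let Q2 : ℝ → ℝ := fun s => η ^ 2 / rr η s ^ 3 / 2
  have hQ : ∀ s, HasDerivAt (fun s => (s + rr η s) / 2) (Q1 s) s := fun s =>
    ((hasDerivAt_id s).add (rr_deriv hη s)).div_const 2
  have hQ1 : ∀ s, HasDerivAt Q1 (Q2 s) s := fun s =>
    ((rr_deriv2 hη s).const_add 1).div_const 2
  have hφx : ∀ x t, HasDerivAt (fun ξ => φ (ξ, t))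
      (p₀ + Hy (Y x t) t + C * (Q1 (s x t) * σ x t)) x := fun x t => by
    have e1 := (hYx x t).const_mul p₀
    have e2 := (hHy (Y x t) t).comp x (hYx x t)
    have e3 := ((hQ (s x t)).comp x (hsx x t)).const_mul C
    have := ((((e1.add e2).sub_const (β * t)).add_const (κ * t ^ (N + 1))).add e3)
    refine HasDerivAt.congr_deriv this ?_
    ring
  have hφxx : ∀ x t, HasDerivAt (fun x => p₀ + Hy (Y x t) t + C * (Q1 (s x t) * σ x t))
      (Hyy (Y x t) t + C * (Q2 (s x t) * σ x t ^ 2 + Q1 (s x t) * (1 / rr 1 (Y x t) ^ 3))) x := by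
    intro x t
    have e2 := (hHyy (Y x t) t).comp x (hYx x t)
    have e3 := (((hQ1 (s x t)).comp x (hsx x t)).mul (hσx x t)).const_mul C
    have := (e2.const_add p₀).add e3
    refine HasDerivAt.congr_deriv this ?_
    simp only [Function.comp]
    ring
  have hφt : ∀ x t, HasDerivAt (fun τ => φ (x, τ))
      (-α * p₀ + (Ht (Y x t) t - α * Hy (Y x t) t) - β + κ * ((N + 1) * t ^ N)
        + C * (Q1 (s x t) * (L - α * σ x t))) t := by
    intro x t
    have e1 := (hYt x t).const_mul p₀
    have e2 := hHt x t
    have e3 := ((hQ (s x t)).comp t (hst x t)).const_mul C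
    have e4 := (hasDerivAt_pow (N + 1) t).const_mul κ
    have := (((e1.add e2).sub ((hasDerivAt_id t).const_mul β)).add e4).add e3
    refine HasDerivAt.congr_deriv this ?_
    simp only [Y]
    push_cast
    ring
  -- lower bound for the barrier
  have hpen : ∀ x t, 0 ≤ (s x t + rr η (s x t)) / 2 ∧ s x t ≤ (s x t + rr η (s x t)) / 2 := by
    intro x t
    have := abs_le.1 (rr_abs η (s x t))
    have h3 := le_abs_self (s x t)
    have h4 := rr_abs η (s x t)
    constructor <;> linarith
  have hlow : ∀ x t, 0 ≤ t → t ≤ 2 → |Y x t| - D + κ * t ^ (N + 1) ≤ φ (x, t) := by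
    intro x t ht ht2
    have e1 : -(|p₀| * |Y x t|) ≤ p₀ * Y x t := by rw [← abs_mul]; exact neg_abs_le _
    have e2 := hHb (Y x t) t ht
    have e3 : β * t ≤ 2 * |β| := by nlinarith [le_abs_self β, abs_nonneg β]
    have e4 : |Y x t| - s₀ ≤ s x t := by
      have := rr_abs 1 (Y x t)
      simp only [s]
      nlinarith
    have e5 := mul_le_mul_of_nonneg_left (e4.trans (hpen x t).2) hCp.le
    have e6 : C * |Y x t| = |p₀| * |Y x t| + δ * |Y x t| + |Y x t| := by rw [hC]; ring
    have e7 : 0 ≤ δ * |Y x t| := by positivity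
    simp only [φ, hD]
    nlinarith
  have key : w (0, 1) ≤ φ (0, 1) := by
    apply aux_compare F ε w φ (D + M + 3 * |α| + 1) (by positivity) hc hsub hφ
    · intro x
      refine (h0 x).trans ?_
      have hYx0 : Y x 0 = x + α := by simp [Y]
      have hφ0 : φ (x, 0) = p₀ * (x + α) + H (x + α) 0 + C * ((s x 0 + rr η (s x 0)) / 2) := by
        simp only [φ, hYx0]; simp
      rw [hφ0]
      obtain ⟨f1, f2⟩ := hpen x 0
      apply max_le
      · have e1 : -(|p₀| * |x + α|) ≤ p₀ * (x + α) := by rw [← abs_mul]; exact neg_abs_le _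
        have e2 := hH0 (x + α)
        have e4 : |x + α| - s₀ ≤ s x 0 := by
          have := rr_abs 1 (x + α)
          simp only [s, hYx0]
          linarith
        have e5 := mul_le_mul_of_nonneg_left (e4.trans f2) hCp.le
        have e6 : C * |x + α| = |p₀| * |x + α| + δ * |x + α| + |x + α| := by rw [hC]; ring
        have := abs_nonneg (x + α)
        nlinarith
      · have := mul_nonneg hCp.le f1
        linarith
    · intro x
      have := hlow x 2 (by norm_num) le_rfl
      have h3 := (abs_le.1 (hM (x, 2))).2
      have := abs_nonneg (Y x 2)
      linarith
    · intro x t ht ht2 hx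
      have := hlow x t ht ht2
      have h3 := (abs_le.1 (hM (x, t))).2
      have h4 : 0 ≤ κ * t ^ (N + 1) := by positivity
      have h5 : |x| ≤ |Y x t| + 3 * |α| := by
        have : x = Y x t + (α * t - α) := by simp only [Y]; ring
        have h6 : |α * t - α| ≤ 3 * |α| := by
          have : α * t - α = α * (t - 1) := by ring
          rw [this, abs_mul]
          have : |t - 1| ≤ 3 := abs_le.2 ⟨by linarith, by linarith⟩
          nlinarith [abs_nonneg α]
        calc |x| = |Y x t + (α * t - α)| := by rw [← this]
          _ ≤ _ := (abs_add_le _ _).trans (by linarith)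
      linarith
    · intro x t ht
      have d1 : deriv (fun ξ => φ (ξ, t)) =
          fun x => p₀ + Hy (Y x t) t + C * (Q1 (s x t) * σ x t) :=
        funext fun x => (hφx x t).deriv
      rw [d1, (hφxx x t).deriv, (hφt x t).deriv]
      have q0 : 0 ≤ Q1 (s x t) ∧ Q1 (s x t) ≤ 1 := by
        have := abs_le.1 (rr_abs1 hη (s x t))
        simp only [Q1]
        constructor <;> linarith
      have qk : η * Q2 (s x t) ≤ 2 * Q1 (s x t) := rr_key hη (s x t)
      have q2 : 0 ≤ Q2 (s x t) := by
        have := rr_pos hη (s x t)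
        simp only [Q2]; positivity
      have hσ : |σ x t| ≤ 1 := rr_abs1 one_pos _
      have hσ2 : 1 / rr 1 (Y x t) ^ 3 ≤ 1 := by
        rw [div_le_one (pow_pos (rr_pos one_pos _) 3)]
        exact one_le_pow₀ (rr_ge one_pos _)
      have hσ3 : 0 ≤ 1 / rr 1 (Y x t) ^ 3 := by
        have := rr_pos one_pos (Y x t)
        positivity
      have hHb' := hHyb (Y x t) t ht
      have hht := hheat (Y x t) t ht
      have hk : 0 < κ * ((N + 1) * t ^ N) := by positivity
      exact aux_alg F ε η α β p₀ δ C LF L _ _ _ _ _ _ _ _ hε hεη hη hη1 hCp hLF hL hlin hLip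
        q0 qk q2 hσ hσ2 hσ3 hHb' hht hk
  have hY01 : Y 0 1 = 0 := by simp [Y]
  have hs01 : s 0 1 = -S := by
    simp only [s, hY01, hs₀]
    simp [rr]
  have : φ (0, 1) = H 0 1 - β + κ + C * ((-S + rr η (-S)) / 2) := by
    simp only [φ, hY01, hs01]; simp
  have h5 := mul_le_mul_of_nonneg_left (rr_decay hη hS) hCp.le
  linarith

lemma aux_neg {F : ℝ → ℝ} {ε : ℝ} {w : ℝ × ℝ → ℝ} (h : IsViscositySupersolution F ε w) :
    IsViscositySubsolution (fun p => -F (-p)) ε (fun p => -w p) := by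
  intro φ hφ x t ht hmax
  have := h (fun p => -φ p) hφ.neg x t ht (by
    have := hmax.neg
    refine this.congr ?_
    exact Filter.Eventually.of_forall fun p => by simp; ring)
  have e : deriv (fun ξ => -φ (ξ, t)) = fun ξ => -deriv (fun ξ => φ (ξ, t)) ξ :=
    funext fun ξ => by simp
  simp only [e, deriv.fun_neg] at this
  simp only
  linarith

/-- If `F ∈ Lip_loc(ℝ)` is linear on some open interval `(a,b)`, then there
exist a bounded Lipschitz initial datum `g` and a constant `c₀ > 0` such that for every
`ε ∈ (0,1/4)`, the viscosity solutions `u^ε` of `u_t + F(u_x) = ε u_xx` and `u` of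
`u_t + F(u_x) = 0` with initial datum `g` satisfy `|u^ε(0,1) - u(0,1)| ≥ c₀ √ε`. -/
theorem statement2
    (F : ℝ → ℝ) (hF : LocallyLipschitz F)
    (a b : ℝ) (hab : a < b)
    (hlin : ∃ α β : ℝ, ∀ p ∈ Set.Ioo a b, F p = α * p + β) :
    ∃ g : ℝ → ℝ, (∃ K : NNReal, LipschitzWith K g) ∧ (∃ M : ℝ, ∀ x : ℝ, |g x| ≤ M) ∧
      ∃ c₀ > (0:ℝ), ∀ ε ∈ Set.Ioo (0:ℝ) (1/4), ∀ uε u : ℝ × ℝ → ℝ,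
        IsViscositySolutionCauchy F ε g uε →
        IsViscositySolutionCauchy F 0 g u →
        c₀ * Real.sqrt ε ≤ |uε (0, 1) - u (0, 1)| := by
  obtain ⟨α, β, hlin⟩ := hlin
  obtain ⟨p₀, hp₀⟩ : ∃ p₀, p₀ = (a + b) / 2 := ⟨_, rfl⟩
  obtain ⟨δ, hδd⟩ : ∃ δ, δ = (b - a) / 4 := ⟨_, rfl⟩
  have hδ : 0 < δ := by rw [hδd]; linarith
  obtain ⟨C, hC⟩ : ∃ C, C = |p₀| + δ + 1 := ⟨_, rfl⟩
  have hCp : 0 < C := by rw [hC]; positivity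
  have hlin' : ∀ q, |q - p₀| ≤ δ → F q = α * q + β := by
    intro q hq
    rw [abs_le] at hq
    apply hlin
    constructor <;> linarith
  obtain ⟨LF, hLF, hLip⟩ : ∃ LF : ℝ, 0 ≤ LF ∧ ∀ p q, |p| ≤ |p₀| + δ + C → |q| ≤ |p₀| + δ + C →
      |F p - F q| ≤ LF * |p - q| := by
    obtain ⟨K, hK⟩ := (hF.locallyLipschitzOn (s := Set.Icc (-(|p₀| + δ + C)) (|p₀| + δ + C))).exists_lipschitzOnWith_of_compact isCompact_Icc
    refine ⟨K, K.2, fun p q hp hq => ?_⟩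
    simpa [Real.dist_eq] using hK.dist_le_mul p (abs_le.1 hp) q (abs_le.1 hq)
  obtain ⟨S, hSd⟩ : ∃ S, S = C / δ := ⟨_, rfl⟩
  have hS : 0 < S := by rw [hSd]; positivity
  obtain ⟨A, hA⟩ : ∃ A, A = C * (1 + (|α| + LF + 3) + S) := ⟨_, rfl⟩
  have hAp : 0 < A := by rw [hA]; positivity
  refine ⟨fun x => max (-A) (min A (p₀ * (x + α) + δ * |x + α|)), ?_, ⟨A, ?_⟩, δ / 8, by positivity, ?_⟩
  · refine ⟨⟨|p₀| + δ, by positivity⟩, ?_⟩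
    apply LipschitzWith.const_max
    apply LipschitzWith.const_min
    apply LipschitzWith.of_dist_le_mul
    intro x y
    change |_ - _| ≤ (|p₀| + δ) * |x - y|
    have e1 : p₀ * (x + α) + δ * |x + α| - (p₀ * (y + α) + δ * |y + α|)
        = p₀ * (x - y) + δ * (|x + α| - |y + α|) := by ring
    rw [e1]
    refine (abs_add_le _ _).trans ?_
    rw [abs_mul, abs_mul, abs_of_pos hδ, add_mul]
    have := abs_abs_sub_abs_le_abs_sub (x + α) (y + α)
    have e2 : x + α - (y + α) = x - y := by ring
    rw [e2] at this
    nlinarith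
  · intro x
    rw [abs_le]
    exact ⟨le_max_left _ _, max_le (by linarith) (min_le_left _ _)⟩
  intro ε hε uε u huε hu
  obtain ⟨hε0, hε4⟩ := hε
  obtain ⟨r, hr⟩ : ∃ r, r = Real.sqrt ε := ⟨_, rfl⟩
  have hrp : 0 < r := by rw [hr]; exact Real.sqrt_pos.2 hε0
  have hr2 : r ^ 2 = ε := by rw [hr]; exact Real.sq_sqrt hε0.le
  have hr1 : r < 1 / 2 := by nlinarith
  have hCS : ∀ η : ℝ, C * (η ^ 2 / (4 * S)) = δ * η ^ 2 / 4 := by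
    intro η
    rw [hSd]; field_simp
  -- upper bound for u
  have hup : u (0, 1) ≤ δ * (r / 16) - β + δ * (r / 16) ^ 2 / 4 := by
    obtain ⟨hM, hc, hsub, -, hi⟩ := hu
    have hη : 0 < r / 16 := by positivity
    have := aux_main F 0 (r / 16) α β p₀ δ C LF S u (fun y _ => δ * rr (r / 16) y)
      (fun y _ => δ * (y / rr (r / 16) y)) (fun y _ => δ * ((r / 16) ^ 2 / rr (r / 16) y ^ 3))
      (fun _ _ => 0) le_rfl hη.le hη (by linarith) hδ hC hLF hS hlin' hLip
      (contDiff_const.mul ((rr_contDiff hη).comp contDiff_fst))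
      (fun y t => (rr_deriv hη y).const_mul δ)
      (fun y t => (rr_deriv2 hη y).const_mul δ)
      (fun x t => by
        have h1 : HasDerivAt (fun τ => x + α - α * τ) (-α) t := by
          simpa using ((hasDerivAt_id t).const_mul α).const_sub (x + α)
        have := ((rr_deriv hη (x + α - α * t)).comp t h1).const_mul δ
        refine HasDerivAt.congr_deriv this ?_
        ring)
      (fun y t _ => by simp)
      (fun y t _ => by
        rw [abs_mul, abs_of_pos hδ]
        have := rr_abs1 hη y
        nlinarith)
      (fun y t _ => by
        have := mul_pos hδ (rr_pos hη y)
        linarith)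
      (fun y => by
        have := mul_pos hδ (rr_pos hη y)
        have := mul_nonneg hδ.le (abs_nonneg y)
        linarith)
      hM hc hsub
      (fun x => by
        rw [hi, ← hA]
        apply max_le_max le_rfl
        refine (min_le_right _ _).trans ?_
        have := mul_le_mul_of_nonneg_left (rr_abs (r / 16) (x + α)) hδ.le
        linarith)
    rw [hCS] at this
    refine this.trans ?_
    have : rr (r / 16) 0 = r / 16 := by
      simp only [rr]
      rw [zero_pow two_ne_zero, zero_add, Real.sqrt_sq hη.le]
    simp only [this]
    exact le_rfl
  -- lower bound for uε
  have hlo : -uε (0, 1) ≤ -(δ * r * (1 - Real.exp (-1))) + β + δ * ε ^ 2 / 4 := by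
    obtain ⟨hM, hc, -, hsup, hi⟩ := huε
    have hcos : ∀ z : ℝ, 1 - Real.cos z ≤ |z| := by
      intro z
      have := Real.abs_cos_sub_cos_le 0 z
      rw [Real.cos_zero, zero_sub, abs_neg] at this
      exact (le_abs_self _).trans this
    have hdy : ∀ y t : ℝ, HasDerivAt (fun y => -(δ * r * (1 - Real.exp (-t) * Real.cos (y / r))))
        (-(δ * (Real.exp (-t) * Real.sin (y / r)))) y := by
      intro y t
      have h1 := (Real.hasDerivAt_cos (y / r)).comp y ((hasDerivAt_id y).div_const r)
      have h2 := (((h1.const_mul (Real.exp (-t))).const_sub 1).const_mul (δ * r)).neg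
      refine HasDerivAt.congr_deriv h2 ?_
      field_simp
    have hH0 : ∀ y : ℝ, -(δ * |y|) ≤ -(δ * r * (1 - Real.exp (-0) * Real.cos (y / r))) := by
      intro y
      have h1 := mul_le_mul_of_nonneg_left (hcos (y / r)) (mul_pos hδ hrp).le
      rw [abs_div, abs_of_pos hrp] at h1
      have : δ * r * (|y| / r) = δ * |y| := by field_simp
      simp only [neg_zero, Real.exp_zero, one_mul]
      linarith
    have := aux_main (fun p => -F (-p)) ε ε α (-β) (-p₀) δ C LF S (fun p => -uε p)
      (fun y t => -(δ * r * (1 - Real.exp (-t) * Real.cos (y / r))))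
      (fun y t => -(δ * (Real.exp (-t) * Real.sin (y / r))))
      (fun y t => -(δ * (Real.exp (-t) * (Real.cos (y / r) / r))))
      (fun y t => -(δ * r * (Real.exp (-t) * Real.cos (y / r)))) hε0.le le_rfl hε0 (by linarith) hδ
      (by rw [abs_neg]; exact hC) hLF hS
      (fun q hq => by
        have := hlin' (-q) (by rw [← abs_neg]; convert hq using 2; ring)
        simp only [this]; ring)
      (fun p q hp hq => by
        rw [abs_neg] at hp hq
        have := hLip (-p) (-q) (by rwa [abs_neg]) (by rwa [abs_neg])
        rw [← abs_neg] at this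
        rw [← abs_neg (p - q)]
        convert this using 2 <;> ring_nf)
      (by fun_prop)
      hdy
      (fun y t => by
        have h1 := (Real.hasDerivAt_sin (y / r)).comp y ((hasDerivAt_id y).div_const r)
        have h2 := ((h1.const_mul (Real.exp (-t))).const_mul δ).neg
        refine HasDerivAt.congr_deriv h2 ?_
        field_simp)
      (fun x t => by
        have h1 : HasDerivAt (fun τ => x + α - α * τ) (-α) t := by
          simpa using ((hasDerivAt_id t).const_mul α).const_sub (x + α)
        have h3 := (Real.hasDerivAt_cos ((x + α - α * t) / r)).comp t (h1.div_const r)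
        have h4 := (Real.hasDerivAt_exp (-t)).comp t (hasDerivAt_neg t)
        have h2 := (((h4.mul h3).const_sub 1).const_mul (δ * r)).neg
        refine HasDerivAt.congr_deriv h2 ?_
        simp only [Function.comp]
        field_simp
        ring)
      (fun y t _ => by
        apply le_of_eq
        rw [← hr2]
        field_simp)
      (fun y t ht => by
        rw [abs_neg, abs_mul, abs_of_pos hδ, abs_mul, abs_of_pos (Real.exp_pos _)]
        have h1 := Real.abs_sin_le_one (y / r)
        have h2 : Real.exp (-t) ≤ 1 := Real.exp_le_one_iff.2 (by linarith)
        have h3 : Real.exp (-t) * |Real.sin (y / r)| ≤ 1 :=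
          mul_le_one₀ h2 (abs_nonneg _) h1
        nlinarith)
      (fun y t ht => by
        have h1 := abs_le.1 (Real.abs_cos_le_one (y / r))
        have h2 : Real.exp (-t) ≤ 1 := Real.exp_le_one_iff.2 (by linarith)
        have h3 := Real.exp_pos (-t)
        have h4 : 1 - Real.exp (-t) * Real.cos (y / r) ≤ 2 := by nlinarith
        have h5 := mul_le_mul_of_nonneg_left h4 (mul_pos hδ hrp).le
        have h6 : δ * r ≤ δ := by nlinarith
        linarith)
      hH0
      (by obtain ⟨M, hM⟩ := hM; exact ⟨M, fun p => by rw [abs_neg]; exact hM p⟩)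
      (uniformContinuous_neg.comp_uniformContinuousOn hc) (aux_neg hsup)
      (fun x => by
        rw [hi, ← hA]
        beta_reduce
        have hb : -(δ * |x + α|) ≤
            -(δ * r * (1 - Real.exp (-0) * Real.cos ((x + α) / r))) := hH0 (x + α)
        rcases le_total A (p₀ * (x + α) + δ * |x + α|) with h | h
        · rw [min_eq_left h]
          exact (neg_le_neg (le_max_right _ _)).trans (le_max_left _ _)
        · rw [min_eq_right h]
          refine (neg_le_neg (le_max_right _ _)).trans (le_trans ?_ (le_max_right _ _))
          linarith)
    rw [hCS] at this
    refine this.trans ?_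
    simp
  have he : Real.exp (-1) < 1 / 2 := by
    have := Real.exp_neg_one_lt_d9
    linarith
  rw [← hr]
  refine le_trans ?_ (le_abs_self _)
  have k1 : δ * r * (1 / 2) ≤ δ * r * (1 - Real.exp (-1)) :=
    mul_le_mul_of_nonneg_left (by linarith) (mul_pos hδ hrp).le
  have k2 : ε ^ 2 ≤ r / 8 := by rw [← hr2]; nlinarith [mul_pos hrp hrp, mul_pos (mul_pos hrp hrp) hrp, mul_pos hrp (sub_pos.2 hr1)]
  have k3 : (r / 16) ^ 2 ≤ r / 16 := by nlinarith
  have k2' := mul_le_mul_of_nonneg_left k2 hδ.le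
  have k3' := mul_le_mul_of_nonneg_left k3 hδ.le
  nlinarith [mul_pos hδ hrp]
end
end
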